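/- Let R be a commutative ring and k ≥ 1. Every k-Dirac finite abstract simplicial complex is decomposition k-chordal over R. -/

import Mathlib

/-!
Basic notions for homological chordality of simplicial complexes,
following Adiprasito–Nevo–Samper, "Higher chordality: From graphs to complexes".

A finite abstract simplicial complex is modelled as a downward-closed finite
family of finite subsets of a vertex type `V`.  Chains of dimension `k` (with
coefficients in a commutative ring `R`) are functions `Finset V → R` supported
on faces of cardinality `k + 1`; the simplicial boundary operator includes the
augmentation (so `0`-cycles are *reduced* cycles), matching the paper's
convention that `C₋₁` is generated by the empty face.
-/

open Finset

attribute [local instance] Classical.propDecidable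

noncomputable section

/-- A finite abstract simplicial complex with vertices in `V`:
a downward-closed finite family of finite subsets of `V`. -/
structure ASC (V : Type*) where
  faces : Finset (Finset V)
  down_closed : ∀ ⦃s t : Finset V⦄, s ∈ faces → t ⊆ s → t ∈ faces

variable {V : Type*} [Fintype V] [LinearOrder V]

/-- `(-1)` to the number of elements of `t` smaller than `v`; this is the sign
of the position of `v` in the ordered set `insert v t`. -/
def esign (v : V) (t : Finset V) : ℤ :=
  (-1) ^ (t.filter fun w => w < v).card

/-- The simplicial boundary operator (including the augmentation at the empty
face): `(bdry c) t = ∑_{v ∉ t} ± c (insert v t)`. -/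
def bdry {R : Type*} [CommRing R] (c : Finset V → R) : Finset V → R :=
  fun t => ∑ v ∈ tᶜ, esign v t • c (insert v t)

/-- `c` is a chain of dimension `k` on the set of faces `S`:
it is supported on members of `S` of cardinality `k + 1`. -/
def IsChainOn {R : Type*} [CommRing R] (S : Set (Finset V)) (k : ℤ)
    (c : Finset V → R) : Prop :=
  ∀ s : Finset V, c s ≠ 0 → s ∈ S ∧ (s.card : ℤ) = k + 1

/-- The vertex support `c⁰` of a chain: all vertices lying in a face with a
nonzero coefficient. -/
def vsupp {R : Type*} [CommRing R] (c : Finset V → R) : Set V :=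
  {v | ∃ s : Finset V, c s ≠ 0 ∧ v ∈ s}

/-- Vanishing of the `k`-th (reduced) homology of the family of faces `S` over `R`:
every `k`-cycle is the boundary of a `(k+1)`-chain. -/
def HVanish (R : Type*) [CommRing R] (S : Set (Finset V)) (k : ℤ) : Prop :=
  ∀ z : Finset V → R, IsChainOn S k z → bdry z = 0 →
    ∃ c : Finset V → R, IsChainOn S (k + 1) c ∧ bdry c = z

/-- `Δ` is resolution `k`-chordal over `R`: every `k`-cycle `z` of `Δ` admits a
resolution, i.e. a `(k+1)`-chain `c` of `Δ` with `∂c = z` and the same vertex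
support as `z`. -/
def ResChordal (R : Type*) [CommRing R] (Δ : ASC V) (k : ℤ) : Prop :=
  ∀ z : Finset V → R, IsChainOn (↑Δ.faces) k z → bdry z = 0 →
    ∃ c : Finset V → R, IsChainOn (↑Δ.faces) (k + 1) c ∧ bdry c = z ∧ vsupp c = vsupp z

/-- `z` is a complete `k`-cycle on the face set `S`: it is a `k`-cycle whose
faces with nonzero coefficient are precisely all the `k`-dimensional faces of
some set `W` of `k + 2` vertices, and all those faces belong to `S`. -/
def IsCompleteCycleOn {R : Type*} [CommRing R] (S : Set (Finset V)) (k : ℤ)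
    (z : Finset V → R) : Prop :=
  bdry z = 0 ∧ ∃ W : Finset V, (W.card : ℤ) = k + 2 ∧
    (∀ s : Finset V, z s ≠ 0 ↔ s ⊆ W ∧ (s.card : ℤ) = k + 1) ∧
    ∀ s : Finset V, s ⊆ W → (s.card : ℤ) = k + 1 → s ∈ S

/-- `Δ` is decomposition `k`-chordal over `R`: every `k`-cycle `z` of `Δ` is a
sum of complete `k`-cycles of `Δ` supporting only vertices supported in `z`. -/
def DecChordal (R : Type*) [CommRing R] (Δ : ASC V) (k : ℤ) : Prop :=
  ∀ z : Finset V → R, IsChainOn (↑Δ.faces) k z → bdry z = 0 →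
    ∃ (n : ℕ) (zs : Fin n → Finset V → R),
      z = ∑ i, zs i ∧
      ∀ i, IsCompleteCycleOn (↑Δ.faces) k (zs i) ∧ vsupp (zs i) ⊆ vsupp z

/-- `σ` is a missing face (minimal nonface) of `Δ`: `σ` is not a face but all
its proper subsets are.  Its dimension is `σ.card - 1`. -/
def IsMissingFace (Δ : ASC V) (σ : Finset V) : Prop :=
  σ ∉ Δ.faces ∧ ∀ t ⊂ σ, t ∈ Δ.faces

/-- The induced subcomplex `Δ|W` on a subset `W` of the vertices. -/
def induced (Δ : ASC V) (W : Finset V) : ASC V where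
  faces := Δ.faces.filter fun s => s ⊆ W
  down_closed := by
    intro s t hs hts
    simp only [mem_filter] at hs ⊢
    exact ⟨Δ.down_closed hs.1 hts, hts.trans hs.2⟩

/-- `Δ` is `k`-Leray over `R`: the reduced homology `H̃ⱼ(Δ|W; R)` vanishes for
every `j ≥ k` and every vertex subset `W`. -/
def IsLeray (R : Type*) [CommRing R] (Δ : ASC V) (k : ℤ) : Prop :=
  ∀ (W : Finset V) (j : ℤ), k ≤ j → HVanish R (((induced Δ W).faces : Set (Finset V))) j

/-- The closed star `St_σ Δ = ∪_{σ ⊆ τ ∈ Δ} 2^τ`. -/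
def star (Δ : ASC V) (σ : Finset V) : ASC V where
  faces := Δ.faces.filter fun s => ∃ τ ∈ Δ.faces, σ ⊆ τ ∧ s ⊆ τ
  down_closed := by
    intro s t hs hts
    simp only [mem_filter] at hs ⊢
    obtain ⟨h1, τ', h2, h3, h4⟩ := hs
    exact ⟨Δ.down_closed h1 hts, τ', h2, h3, hts.trans h4⟩

/-- The deletion `Δ - σ`: the maximal subcomplex of `Δ` not containing `σ`. -/
def del (Δ : ASC V) (σ : Finset V) : ASC V where
  faces := Δ.faces.filter fun s => ¬ σ ⊆ s
  down_closed := by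
    intro s t hs hts
    simp only [mem_filter] at hs ⊢
    exact ⟨Δ.down_closed hs.1 hts, fun h => hs.2 (h.trans hts)⟩

/-- The extended link `eLk_σ Δ = St_σ Δ - σ`. -/
def eLk (Δ : ASC V) (σ : Finset V) : ASC V := del (star Δ σ) σ

/-- The link `Lk_σ Δ = {τ \ σ : σ ⊆ τ ∈ Δ}`. -/
def link (Δ : ASC V) (σ : Finset V) : ASC V where
  faces := Finset.univ.filter fun t => Disjoint σ t ∧ σ ∪ t ∈ Δ.faces
  down_closed := by
    intro s t hs hts
    simp only [mem_filter, mem_univ, true_and] at hs ⊢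
    exact ⟨hs.1.mono_right hts, Δ.down_closed hs.2 (union_subset_union_right hts)⟩

/-- The `k`-clique complex `Cl_k Δ`: faces are the sets of vertices of `Δ` all
of whose subsets of cardinality at most `k + 1` are faces of `Δ`. -/
def clique (Δ : ASC V) (k : ℤ) : ASC V where
  faces := Finset.univ.filter fun s =>
    (∀ v ∈ s, {v} ∈ Δ.faces) ∧ ∀ t ⊆ s, (t.card : ℤ) ≤ k + 1 → t ∈ Δ.faces
  down_closed := by
    intro s t hs hts
    simp only [mem_filter, mem_univ, true_and] at hs ⊢
    exact ⟨fun v hv => hs.1 v (hts hv), fun u hu hc => hs.2 u (hu.trans hts) hc⟩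

/-- The vertex set of a complex, as a set of elements of `V`. -/
def vertexSet (Δ : ASC V) : Set V := {v | {v} ∈ Δ.faces}

/-- The relative simplicial complex `(Δ, Γ)` is resolution `k`-chordal over `R`:
every relative `k`-cycle (a `k`-chain of `Δ` supported off `Γ` whose boundary
is a chain of `Γ`) admits a resolution, i.e. a `(k+1)`-chain `c` of `Δ`
supported off `Γ` with `∂c ≡ z` modulo chains of `Γ` and `vsupp c = vsupp z`. -/
def RelResChordal (R : Type*) [CommRing R] (Δ Γ : ASC V) (k : ℤ) : Prop :=
  ∀ z : Finset V → R, IsChainOn (↑Δ.faces) k z → (∀ s, z s ≠ 0 → s ∉ Γ.faces) →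
    IsChainOn (↑Γ.faces) (k - 1) (bdry z) →
    ∃ c : Finset V → R, IsChainOn (↑Δ.faces) (k + 1) c ∧ (∀ s, c s ≠ 0 → s ∉ Γ.faces) ∧
      IsChainOn (↑Γ.faces) k (bdry c - z) ∧ vsupp c = vsupp z

/-- The union of two simplicial complexes (taken facewise). -/
def aunion (Δ Γ : ASC V) : ASC V where
  faces := Δ.faces ∪ Γ.faces
  down_closed := by
    intro s t hs hts
    rcases Finset.mem_union.1 hs with h | h
    · exact Finset.mem_union.2 (Or.inl (Δ.down_closed h hts))
    · exact Finset.mem_union.2 (Or.inr (Γ.down_closed h hts))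

/-- The intersection of two simplicial complexes (taken facewise). -/
def ainter (Δ Γ : ASC V) : ASC V where
  faces := Δ.faces ∩ Γ.faces
  down_closed := by
    intro s t hs hts
    rw [Finset.mem_inter] at hs ⊢
    exact ⟨Δ.down_closed hs.1 hts, Γ.down_closed hs.2 hts⟩

/-- The `k`-skeleton of `Δ`: all faces of dimension at most `k`. -/
def skel (Δ : ASC V) (k : ℤ) : ASC V where
  faces := Δ.faces.filter fun s => (s.card : ℤ) ≤ k + 1
  down_closed := by
    intro s t hs hts
    simp only [mem_filter] at hs ⊢
    refine ⟨Δ.down_closed hs.1 hts, le_trans ?_ hs.2⟩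
    exact_mod_cast Finset.card_le_card hts

/-- The recursive notion of a `k`-Dirac complex (Section 6): either the
`k`-skeleton of `Δ` is the `k`-skeleton of a simplex, or there is a face `σ`
of dimension at most `k - 1` such that `Δ - σ` is `k`-Dirac, the extended link
`eLk_σ Δ` is `(k-1)`-Dirac and `Cl_{k-1}(eLk_σ Δ) = eLk_σ(Cl_k Δ)`. -/
inductive IsDirac {V : Type*} [Fintype V] [LinearOrder V] : ℤ → ASC V → Prop
  | complete (k : ℤ) (Δ : ASC V) (W : Finset V)
      (h : Δ.faces.filter (fun s => (s.card : ℤ) ≤ k + 1) =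
        W.powerset.filter fun s => (s.card : ℤ) ≤ k + 1) :
      IsDirac k Δ
  | step (k : ℤ) (Δ : ASC V) (σ : Finset V)
      (hσ : σ ∈ Δ.faces) (hcard : (σ.card : ℤ) ≤ k)
      (hdel : IsDirac k (del Δ σ)) (helk : IsDirac (k - 1) (eLk Δ σ))
      (hcl : (clique (eLk Δ σ) (k - 1)).faces = (eLk (clique Δ k) σ).faces) :
      IsDirac k Δ

section Boundary

variable {R : Type*} [CommRing R]

theorem esign_insert (v w : V) {t : Finset V} (hw : w ∉ t) :
    esign v (insert w t) = (if w < v then -1 else 1) * esign v t := by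
  unfold esign
  rw [Finset.filter_insert]
  split_ifs with h
  · rw [Finset.card_insert_of_notMem (by simp [hw]), pow_succ]
    ring
  · simp

theorem esign_mul_self (v : V) (t : Finset V) : esign v t * esign v t = 1 := by
  rw [esign, ← mul_pow]
  simp

theorem esign_smul_ne_zero (v : V) (t : Finset V) {a : R} (ha : a ≠ 0) :
    esign v t • a ≠ 0 := by
  intro h
  apply ha
  rw [← one_smul ℤ a, ← esign_mul_self v t, mul_smul, h, smul_zero]

theorem bdry_add (c d : Finset V → R) : bdry (c + d) = bdry c + bdry d := by
  funext t
  simp [bdry, Finset.sum_add_distrib]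

theorem bdry_zero : bdry (0 : Finset V → R) = 0 := by
  funext t
  simp [bdry]

theorem bdry_sum {ι : Type*} (S : Finset ι) (f : ι → Finset V → R) :
    bdry (∑ i ∈ S, f i) = ∑ i ∈ S, bdry (f i) :=
  map_sum (AddMonoidHom.mk' (bdry : (Finset V → R) → Finset V → R) bdry_add) f S

theorem bdry_sub (c d : Finset V → R) : bdry (c - d) = bdry c - bdry d :=
  map_sub (AddMonoidHom.mk' (bdry : (Finset V → R) → Finset V → R) bdry_add) c d

theorem exists_of_bdry_ne_zero {c : Finset V → R} {t : Finset V} (h : bdry c t ≠ 0) :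
    ∃ v ∉ t, c (insert v t) ≠ 0 := by
  obtain ⟨v, hv, hne⟩ := Finset.exists_ne_zero_of_sum_ne_zero h
  refine ⟨v, by simpa using hv, fun h0 => hne ?_⟩
  rw [h0, smul_zero]

theorem vsupp_bdry_subset (c : Finset V → R) : vsupp (bdry c) ⊆ vsupp c := by
  rintro v ⟨t, ht, hv⟩
  obtain ⟨w, -, hw⟩ := exists_of_bdry_ne_zero ht
  exact ⟨_, hw, Finset.mem_insert_of_mem hv⟩

/-- The cone over a chain with apex `v`; faces already containing `v` are sent to zero. -/
def cone (v : V) (c : Finset V → R) : Finset V → R :=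
  fun s => if v ∈ s then esign v (s.erase v) • c (s.erase v) else 0

theorem cone_zero (v : V) : cone v (0 : Finset V → R) = 0 := by
  funext s
  simp [cone]

theorem of_cone_ne_zero {v : V} {c : Finset V → R} {s : Finset V} (h : cone v c s ≠ 0) :
    v ∈ s ∧ c (s.erase v) ≠ 0 := by
  unfold cone at h
  split_ifs at h with hv
  · exact ⟨hv, fun h0 => h (by rw [h0, smul_zero])⟩
  · exact absurd rfl h

/-- Coning is a contracting homotopy of the augmented chain complex. -/
theorem bdry_cone_add_cone_bdry (v : V) (c : Finset V → R) :
    bdry (cone v c) + cone v (bdry c) = c := by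
  funext t
  rw [Pi.add_apply]
  by_cases hv : v ∈ t
  · obtain ⟨u, hu, rfl⟩ : ∃ u, v ∉ u ∧ insert v u = t :=
      ⟨t.erase v, by simp, Finset.insert_erase hv⟩
    have hcompl : uᶜ = insert v (insert v u)ᶜ := by
      ext w
      simp only [Finset.mem_compl, Finset.mem_insert]
      by_cases hw : w = v
      · simp [hw, hu]
      · simp [hw]
    have hcone : cone v (bdry c) (insert v u) = esign v u • bdry c u := by
      simp [cone, Finset.erase_insert hu]
    rw [hcone]
    unfold bdry
    rw [hcompl, Finset.sum_insert (by simp), smul_add, smul_smul, esign_mul_self, one_smul,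
      Finset.smul_sum, add_left_comm, ← Finset.sum_add_distrib, Finset.sum_eq_zero, add_zero]
    intro w hw
    simp only [Finset.mem_compl, Finset.mem_insert, not_or] at hw
    obtain ⟨hwv, hwu⟩ := hw
    have hvw : v ∉ insert w u := by simp [hu, Ne.symm hwv]
    have h1 : cone v c (insert w (insert v u)) = esign v (insert w u) • c (insert w u) := by
      rw [Finset.insert_comm, cone, if_pos (Finset.mem_insert_self _ _),
        Finset.erase_insert hvw]
    rw [h1, smul_smul, smul_smul, ← add_smul, esign_insert w v hu, esign_insert v w hwu]
    rcases lt_or_gt_of_ne hwv with h | h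
    · rw [if_neg h.not_gt, if_pos h, ← zero_smul ℤ (c (insert w u))]
      ring_nf
    · rw [if_pos h, if_neg h.not_gt, ← zero_smul ℤ (c (insert w u))]
      ring_nf
  · have hz : cone v (bdry c) t = 0 := by simp [cone, hv]
    rw [hz, add_zero, bdry, Finset.sum_eq_single v]
    · rw [cone, if_pos (Finset.mem_insert_self _ _), Finset.erase_insert hv, smul_smul,
        esign_mul_self, one_smul]
    · intro w _ hwv
      rw [cone, if_neg (by simp [hv, Ne.symm hwv]), smul_zero]
    · simp [hv]

theorem bdry_cone (v : V) (c : Finset V → R) : bdry (cone v c) = c - cone v (bdry c) :=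
  eq_sub_of_add_eq (bdry_cone_add_cone_bdry v c)

/-- The chain with coefficient `a` on the simplex `s` and zero elsewhere. -/
def simplexChain (s : Finset V) (a : R) : Finset V → R :=
  fun t => if t = s then a else 0

theorem sum_simplexChain (c : Finset V → R) :
    ∑ s ∈ Finset.univ.filter (fun s => c s ≠ 0), simplexChain s (c s) = c := by
  funext t
  simp only [Finset.sum_apply, simplexChain]
  rw [Finset.sum_ite_eq]
  by_cases h : c t = 0 <;> simp [h]

theorem simplexChain_eq_cone {v : V} {s : Finset V} (hv : v ∈ s) (a : R) :
    simplexChain s a =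
      cone v (simplexChain (s.erase v) (esign v (s.erase v) • a)) := by
  funext t
  by_cases hts : t = s
  · subst hts
    rw [cone, if_pos hv, simplexChain, simplexChain, if_pos rfl, if_pos rfl, smul_smul,
      esign_mul_self, one_smul]
  · rw [simplexChain, if_neg hts]
    by_contra h
    obtain ⟨hvt, hne⟩ := of_cone_ne_zero (Ne.symm h)
    refine hne (if_neg fun he => hts ?_)
    rw [← Finset.insert_erase hvt, he, Finset.insert_erase hv]

theorem bdry_bdry_simplexChain (s : Finset V) (a : R) :
    bdry (bdry (simplexChain s a)) = 0 := by
  induction s using Finset.strongInduction generalizing a with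
  | H s ih =>
    obtain rfl | ⟨v, hv⟩ := s.eq_empty_or_nonempty
    · have h : bdry (simplexChain (∅ : Finset V) a) = 0 := by
        funext t
        simp [bdry, simplexChain]
      rw [h, bdry_zero]
    · rw [simplexChain_eq_cone hv, bdry_cone, bdry_sub, bdry_cone,
        ih _ (Finset.erase_ssubset hv), cone_zero, sub_zero, sub_self]

theorem bdry_bdry (c : Finset V → R) : bdry (bdry c) = 0 := by
  rw [← sum_simplexChain c, bdry_sum, bdry_sum]
  exact Finset.sum_eq_zero fun s _ => bdry_bdry_simplexChain s _

theorem bdry_simplexChain_ne_zero_iff {W s : Finset V} {a : R} (ha : a ≠ 0) :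
    bdry (simplexChain W a) s ≠ 0 ↔ s ⊆ W ∧ s.card + 1 = W.card := by
  constructor
  · intro h
    obtain ⟨v, hv, hne⟩ := exists_of_bdry_ne_zero h
    obtain rfl : insert v s = W := by
      by_contra hW
      exact hne (if_neg hW)
    exact ⟨Finset.subset_insert _ _, (Finset.card_insert_of_notMem hv).symm⟩
  · rintro ⟨hs, hcard⟩
    obtain ⟨v, hv, rfl⟩ := (Finset.exists_eq_insert_iff).2 ⟨hs, hcard⟩
    rw [bdry, Finset.sum_eq_single v]
    · rw [simplexChain, if_pos rfl]
      exact esign_smul_ne_zero v s ha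
    · intro w hw hwv
      rw [simplexChain, if_neg, smul_zero]
      intro h
      have : w ∈ insert v s := h ▸ Finset.mem_insert_self w s
      rw [Finset.mem_insert] at this
      exact this.elim hwv (by simpa using hw)
    · simp [hv]

end Boundary

section Filling

variable {R : Type*} [CommRing R]

/-- `c` is a `(k+1)`-chain on vertices in `U`, all of whose simplices have their `k`-faces
in `Δ`. -/
def IsCliqueChain (Δ : ASC V) (k : ℤ) (U : Set V) (c : Finset V → R) : Prop :=
  ∀ s : Finset V, c s ≠ 0 → (s.card : ℤ) = k + 2 ∧ (∀ v ∈ s, v ∈ U) ∧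
    ∀ t ⊆ s, (t.card : ℤ) = k + 1 → t ∈ Δ.faces

theorem IsCliqueChain.mono {Δ Γ : ASC V} {k : ℤ} {U U' : Set V} {c : Finset V → R}
    (h : IsCliqueChain Δ k U c) (hΔ : Δ.faces ⊆ Γ.faces) (hU : U ⊆ U') :
    IsCliqueChain Γ k U' c := fun s hs =>
  ⟨(h s hs).1, fun v hv => hU ((h s hs).2.1 v hv), fun t ht htc => hΔ ((h s hs).2.2 t ht htc)⟩

theorem IsCliqueChain.sub {Δ : ASC V} {k : ℤ} {U : Set V} {c d : Finset V → R}
    (hc : IsCliqueChain Δ k U c) (hd : IsCliqueChain Δ k U d) :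
    IsCliqueChain Δ k U (c - d) := by
  intro s hs
  by_cases h : c s = 0
  · exact hd s fun h' => hs (by simp [h, h'])
  · exact hc s h

/-- The boundary of a clique chain is a sum of complete cycles. -/
theorem IsCliqueChain.exists_sum_complete {Δ : ASC V} {k : ℤ} {U : Set V} {c : Finset V → R}
    (hc : IsCliqueChain Δ k U c) :
    ∃ (n : ℕ) (zs : Fin n → Finset V → R), bdry c = ∑ i, zs i ∧
      ∀ i, IsCompleteCycleOn (↑Δ.faces) k (zs i) ∧ vsupp (zs i) ⊆ U := by
  let S : Finset (Finset V) := Finset.univ.filter fun s => c s ≠ 0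
  have hsum : bdry c = ∑ s ∈ S, bdry (simplexChain s (c s)) := by
    rw [← bdry_sum, sum_simplexChain]
  refine ⟨S.card,
    fun i => bdry (simplexChain (S.equivFin.symm i).1 (c (S.equivFin.symm i).1)), ?_, ?_⟩
  · rw [hsum, ← Finset.sum_coe_sort S]
    exact (Equiv.sum_comp S.equivFin.symm fun s : S => bdry (simplexChain s.1 (c s.1))).symm
  · intro i
    dsimp only
    obtain ⟨s, hs⟩ := S.equivFin.symm i
    have hne : c s ≠ 0 := by simpa [S] using hs
    obtain ⟨hcard, hU, hfaces⟩ := hc s hne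
    refine ⟨⟨bdry_bdry _, s, hcard, fun t => ?_, hfaces⟩, ?_⟩
    · rw [bdry_simplexChain_ne_zero_iff hne]
      dsimp only
      refine and_congr_right fun _ => ?_
      omega
    · rintro v ⟨t, ht, hv⟩
      exact hU v (((bdry_simplexChain_ne_zero_iff hne).1 ht).1 hv)

theorem empty_mem_of_isDirac {k : ℤ} {Δ : ASC V} (hk : -1 ≤ k) (h : IsDirac k Δ) :
    ∅ ∈ Δ.faces := by
  cases h with
  | complete _ _ W h =>
    have : ∅ ∈ W.powerset.filter fun s => (s.card : ℤ) ≤ k + 1 := by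
      simp
      omega
    rw [← h] at this
    exact (Finset.mem_filter.1 this).1
  | step _ _ σ hσ => exact Δ.down_closed hσ (Finset.empty_subset _)

/-- In a complex with complete `k`-skeleton, cycles are filled by coning from a supported
vertex. -/
theorem exists_isCliqueChain_of_complete {k : ℤ} (hk : 0 ≤ k) {Δ : ASC V} {W : Finset V}
    (h : Δ.faces.filter (fun s => (s.card : ℤ) ≤ k + 1) =
      W.powerset.filter fun s => (s.card : ℤ) ≤ k + 1)
    {z : Finset V → R} (hz : IsChainOn (↑Δ.faces) k z) (hbz : bdry z = 0) :
    ∃ c : Finset V → R, bdry c = z ∧ IsCliqueChain Δ k (vsupp z) c := by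
  have hmem : ∀ s : Finset V, (s.card : ℤ) ≤ k + 1 → (s ∈ Δ.faces ↔ s ⊆ W) := by
    intro s hs
    have := Finset.ext_iff.1 h s
    simpa [hs] using this
  by_cases hz0 : z = 0
  · exact ⟨0, by rw [hz0, bdry_zero], fun s hs => absurd rfl hs⟩
  obtain ⟨s₀, hs₀⟩ := Function.ne_iff.1 hz0
  obtain ⟨hs₀Δ, hs₀c⟩ := hz s₀ hs₀
  obtain ⟨v, hv⟩ : s₀.Nonempty := by
    rw [← Finset.card_pos]
    omega
  refine ⟨cone v z, by rw [bdry_cone, hbz, cone_zero, sub_zero], fun s hs => ?_⟩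
  obtain ⟨hvs, hne⟩ := of_cone_ne_zero hs
  obtain ⟨hΔ, hc⟩ := hz _ hne
  have hcard := Finset.card_erase_add_one hvs
  refine ⟨by omega, fun w hw => ?_, fun t hts htc => ?_⟩
  · by_cases hwv : w = v
    · exact ⟨s₀, hs₀, hwv ▸ hv⟩
    · exact ⟨_, hne, Finset.mem_erase.2 ⟨hwv, hw⟩⟩
  · rw [hmem t htc.le]
    intro w hw
    by_cases hwv : w = v
    · exact hwv ▸ (hmem s₀ hs₀c.le).1 hs₀Δ hv
    · exact (hmem _ hc.le).1 hΔ (Finset.mem_erase.2 ⟨hwv, hts hw⟩)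

/-- The simplices of a clique chain belong to the clique complex. -/
theorem IsCliqueChain.mem_clique {Δ : ASC V} {k : ℤ} (hk : 0 ≤ k) {U : Set V}
    {c : Finset V → R} (hc : IsCliqueChain Δ k U c) {s : Finset V} (hs : c s ≠ 0) :
    s ∈ (clique Δ k).faces := by
  obtain ⟨hcard, -, hfaces⟩ := hc s hs
  have hsub : ∀ t ⊆ s, (t.card : ℤ) ≤ k + 1 → t ∈ Δ.faces := by
    intro t ht htc
    obtain ⟨u, htu, hus, huc⟩ :=
      Finset.exists_subsuperset_card_eq (n := (k + 1).toNat) ht (by omega) (by omega)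
    exact Δ.down_closed (hfaces u hus (by omega)) htu
  simp only [clique, Finset.mem_filter, Finset.mem_univ, true_and]
  exact ⟨fun v hv => hsub {v} (by simpa using hv) (by simp; omega), hsub⟩

theorem exists_isCliqueChain_of_step {k : ℤ} (hk : 1 ≤ k) {Δ : ASC V} {σ : Finset V}
    (hσ : σ.Nonempty)
    (hcl : (clique (eLk Δ σ) (k - 1)).faces = (eLk (clique Δ k) σ).faces)
    (hdel : ∀ z : Finset V → R, IsChainOn (↑(del Δ σ).faces) k z → bdry z = 0 →
      ∃ c, bdry c = z ∧ IsCliqueChain (del Δ σ) k (vsupp z) c)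
    (helk : ∀ z : Finset V → R, IsChainOn (↑(eLk Δ σ).faces) (k - 1) z → bdry z = 0 →
      ∃ c, bdry c = z ∧ IsCliqueChain (eLk Δ σ) (k - 1) (vsupp z) c)
    {z : Finset V → R} (hz : IsChainOn (↑Δ.faces) k z) (hbz : bdry z = 0) :
    ∃ c : Finset V → R, bdry c = z ∧ IsCliqueChain Δ k (vsupp z) c := by
  have hdelΔ : (del Δ σ).faces ⊆ Δ.faces := Finset.filter_subset _ _
  by_cases hex : ∃ s, z s ≠ 0 ∧ σ ⊆ s
  swap
  · push Not at hex
    obtain ⟨c, hbc, hc⟩ := hdel z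
      (fun s hs => ⟨Finset.mem_filter.2 ⟨(hz s hs).1, hex s hs⟩, (hz s hs).2⟩) hbz
    exact ⟨c, hbc, hc.mono hdelΔ subset_rfl⟩
  obtain ⟨s₀, hs₀, hσs₀⟩ := hex
  obtain ⟨v, hv⟩ := hσ
  let x : Finset V → R := fun s => if σ ⊆ s then z s else 0
  have hx : ∀ s, x s ≠ 0 → σ ⊆ s ∧ z s ≠ 0 := by
    intro s hs
    by_cases h : σ ⊆ s <;> simp_all [x]
  have hzx : ∀ s, (z - x) s ≠ 0 → ¬ σ ⊆ s ∧ z s ≠ 0 := by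
    intro s hs
    by_cases h : σ ⊆ s <;> simp_all [x]
  have hxz : vsupp x ⊆ vsupp z := fun w ⟨s, hs, hw⟩ => ⟨s, (hx s hs).2, hw⟩
  have hbx : IsChainOn (↑(eLk Δ σ).faces) (k - 1) (bdry x) := by
    intro t ht
    obtain ⟨w, hwt, hw⟩ := exists_of_bdry_ne_zero ht
    obtain ⟨hσw, hzw⟩ := hx _ hw
    obtain ⟨hΔ, hcard⟩ := hz _ hzw
    rw [Finset.card_insert_of_notMem hwt] at hcard
    refine ⟨?_, by push_cast at hcard; omega⟩
    simp only [eLk, del, _root_.star, Finset.coe_filter, Finset.mem_filter, Set.mem_ofPred_eq]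
    refine ⟨⟨Δ.down_closed hΔ (Finset.subset_insert _ _), _, hΔ, hσw,
      Finset.subset_insert _ _⟩, fun hσt => ht ?_⟩
    by_contra hne
    have hne' : bdry (z - x) t ≠ 0 := by
      rw [bdry_sub, hbz]
      simpa using hne
    obtain ⟨u, -, hu⟩ := exists_of_bdry_ne_zero hne'
    exact (hzx _ hu).1 (hσt.trans (Finset.subset_insert _ _))
  obtain ⟨c, hbc, hc⟩ := helk _ hbx (bdry_bdry x)
  have hcs : ∀ s, c s ≠ 0 → s ∈ (clique Δ k).faces ∧ ¬ σ ⊆ s ∧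
      ∃ τ ∈ (clique Δ k).faces, σ ⊆ τ ∧ s ⊆ τ := by
    intro s hs
    have h := hc.mem_clique (by omega) hs
    rw [hcl] at h
    simp only [eLk, del, _root_.star, Finset.mem_filter] at h
    exact ⟨h.1.1, h.2, h.1.2⟩
  have hcU : ∀ s, c s ≠ 0 → ∀ w ∈ s, w ∈ vsupp z := fun s hs w hw =>
    hxz (vsupp_bdry_subset x ((hc s hs).2.1 w hw))
  have hclique : ∀ s ∈ (clique Δ k).faces, ∀ t ⊆ s, (t.card : ℤ) ≤ k + 1 → t ∈ Δ.faces := by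
    intro s hs
    exact (Finset.mem_filter.1 hs).2.2
  have hne : ∀ s, (z - x + c) s ≠ 0 → (z - x) s ≠ 0 ∨ c s ≠ 0 := by
    intro s hs
    by_contra! h
    exact hs (by rw [Pi.add_apply, h.1, h.2, add_zero])
  obtain ⟨d, hbd, hd⟩ := hdel (z - x + c) (by
    intro s hs
    rcases hne s hs with h | h
    · obtain ⟨h1, h2⟩ := hzx s h
      exact ⟨Finset.mem_filter.2 ⟨(hz s h2).1, h1⟩, (hz s h2).2⟩
    · have hcard := (hc s h).1
      exact ⟨Finset.mem_filter.2 ⟨hclique s (hcs s h).1 s subset_rfl (by omega),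
        (hcs s h).2.1⟩, by omega⟩)
    (by rw [bdry_add, bdry_sub, hbz, hbc, zero_sub, neg_add_cancel])
  have hsupp : vsupp (z - x + c) ⊆ vsupp z := by
    rintro w ⟨s, hs, hw⟩
    rcases hne s hs with h | h
    · exact ⟨s, (hzx s h).2, hw⟩
    · exact hcU s h w hw
  have hconex : cone v x = 0 := by
    funext s
    by_contra hs
    exact Finset.notMem_erase v s ((hx _ (of_cone_ne_zero hs).2).1 hv)
  have hbcone : bdry (cone v c) = c - x := by
    have h := bdry_cone v x
    rw [hconex, bdry_zero] at h
    rw [bdry_cone, hbc, ← sub_eq_zero.1 h.symm]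
  refine ⟨d - cone v c, by rw [bdry_sub, hbd, hbcone]; abel,
    (hd.mono hdelΔ hsupp).sub fun s hs => ?_⟩
  obtain ⟨hvs, hcne⟩ := of_cone_ne_zero hs
  have hcard := Finset.card_erase_add_one hvs
  have hcard' := (hc _ hcne).1
  obtain ⟨-, -, τ, hτ, hστ, hsτ⟩ := hcs _ hcne
  refine ⟨by omega, fun w hw => ?_, fun t hts htc => hclique τ hτ t ?_ htc.le⟩
  · by_cases hwv : w = v
    · exact ⟨s₀, hs₀, hσs₀ (hwv ▸ hv)⟩
    · exact hcU _ hcne w (Finset.mem_erase.2 ⟨hwv, hw⟩)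
  · intro w hw
    by_cases hwv : w = v
    · exact hστ (hwv ▸ hv)
    · exact hsτ (Finset.mem_erase.2 ⟨hwv, hts hw⟩)

theorem IsDirac.exists_isCliqueChain {k : ℤ} {Δ : ASC V} (h : IsDirac k Δ) (hk : 0 ≤ k)
    (z : Finset V → R) (hz : IsChainOn (↑Δ.faces) k z) (hbz : bdry z = 0) :
    ∃ c : Finset V → R, bdry c = z ∧ IsCliqueChain Δ k (vsupp z) c := by
  induction h generalizing z with
  | complete k Δ W h => exact exists_isCliqueChain_of_complete hk h hz hbz
  | step k Δ σ hσ hcard hdel helk hcl ihdel ihelk =>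
    have hne : σ.Nonempty := by
      rw [Finset.nonempty_iff_ne_empty]
      rintro rfl
      have := empty_mem_of_isDirac (by omega) hdel
      simp [del] at this
    have hk1 : 1 ≤ k := by
      have := hne.card_pos
      omega
    exact exists_isCliqueChain_of_step hk1 hne hcl (ihdel hk) (ihelk (by omega)) hz hbz

end Filling

/-- Proposition 6.3: every `k`-Dirac complex is decomposition `k`-chordal over
any commutative ring `R`. -/
theorem isDirac_decChordal {V : Type*} [Fintype V] [LinearOrder V]
    (R : Type*) [CommRing R] (k : ℤ) (hk : 1 ≤ k) (Δ : ASC V)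
    (h : IsDirac k Δ) : DecChordal R Δ k := by
  intro z hz hbz
  obtain ⟨c, rfl, hc⟩ := h.exists_isCliqueChain (by omega) z hz hbz
  exact hc.exists_sum_complete
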